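/- Let K ≥ 2 be an integer, let α satisfy Condition A, let γ > 0 be such that μ = Cauchy(γ) is invariant under the SGB map S_{K,α}. Then the system is mixing: for all Borel sets A, B ⊆ ℝ, μ((S_{K,α}^n)⁻¹(A) ∩ B) → μ(A)·μ(B) as n → ∞, where S_{K,α}^n denotes the n-fold iterate of S_{K,α}. -/

import Mathlib

open MeasureTheory Real Filter

/-- The cotangent function `cot t = cos t / sin t`. -/
noncomputable def cot' (t : ℝ) : ℝ := Real.cos t / Real.sin t

/-- `arccot x = π/2 - arctan x ∈ (0, π)`. -/
noncomputable def arccot' (x : ℝ) : ℝ := Real.pi / 2 - Real.arctan x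

/-- The Super Generalized Boole (SGB) map `S_{K,α}(x) = α K cot(K arccot x)`. -/
noncomputable def SGB (K : ℕ) (α : ℝ) (x : ℝ) : ℝ := α * K * cot' (K * arccot' x)

/-- The Cauchy probability measure with scale parameter `γ`. -/
noncomputable def cauchyMeasure (γ : ℝ) : Measure ℝ :=
  MeasureTheory.volume.withDensity (fun x => ENNReal.ofReal (γ / (Real.pi * (x ^ 2 + γ ^ 2))))

/-- The involutive automorphism `z ↦ (a - z) / (1 - a z)` of the unit disk exchanging `0` and the
real point `a`. -/
noncomputable def diskInvolution (a : ℝ) (z : ℂ) : ℂ := (a - z) / (1 - a * z)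

/-- The Blaschke product obtained from `z ↦ z ^ K` by pre- and post-composition with disk
involutions. -/
noncomputable def powBlaschke (K : ℕ) (a b : ℝ) (z : ℂ) : ℂ :=
  diskInvolution b (diskInvolution a z ^ K)

/-- The Cayley transform of the half-plane model onto the disk sending `iγ` to `0`, restricted to
the real line. -/
noncomputable def cayley (γ x : ℝ) : ℂ := (γ + x * Complex.I) / (γ - x * Complex.I)

/-- The angular coordinate of the Cayley transform of `x`. -/
noncomputable def cayleyAngle (γ x : ℝ) : AddCircle (2 * π) := ((2 * arctan (x / γ) : ℝ) :)

theorem one_sub_ofReal_mul_ne_zero {a : ℝ} (ha : |a| < 1) {z : ℂ} (hz : ‖z‖ ≤ 1) :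
    1 - (a : ℂ) * z ≠ 0 := by
  intro h
  have h1 : (a : ℂ) * z = 1 := (sub_eq_zero.mp h).symm
  have h2 : |a| * ‖z‖ = 1 := by simpa using congrArg norm h1
  nlinarith [abs_nonneg a, norm_nonneg z]

theorem norm_sq_one_sub_sub_norm_sq (a : ℝ) (z : ℂ) :
    ‖1 - (a : ℂ) * z‖ ^ 2 - ‖(a : ℂ) - z‖ ^ 2 = (1 - a ^ 2) * (1 - ‖z‖ ^ 2) := by
  simp only [← Complex.normSq_eq_norm_sq, Complex.normSq_apply]
  simp
  ring

theorem norm_diskInvolution_le_one {a : ℝ} (ha : |a| < 1) {z : ℂ} (hz : ‖z‖ ≤ 1) :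
    ‖diskInvolution a z‖ ≤ 1 := by
  have h := norm_sq_one_sub_sub_norm_sq a z
  have ha' : a ^ 2 < 1 := (sq_lt_one_iff_abs_lt_one a).mpr ha
  have hz' : ‖z‖ ^ 2 ≤ 1 := pow_le_one₀ (norm_nonneg z) hz
  rw [diskInvolution, norm_div]
  refine div_le_one_of_le₀ ?_ (norm_nonneg _)
  refine le_of_sq_le_sq ?_ (norm_nonneg _)
  nlinarith

theorem differentiableAt_diskInvolution {a : ℝ} (ha : |a| < 1) {z : ℂ} (hz : ‖z‖ ≤ 1) :
    DifferentiableAt ℂ (diskInvolution a) z := by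
  unfold diskInvolution
  exact DifferentiableAt.div (by fun_prop) (by fun_prop) (one_sub_ofReal_mul_ne_zero ha hz)

section powBlaschke

variable {K : ℕ} {a b : ℝ}

theorem norm_powBlaschke_le_one (ha : |a| < 1) (hb : |b| < 1) {z : ℂ} (hz : ‖z‖ ≤ 1) :
    ‖powBlaschke K a b z‖ ≤ 1 := by
  refine norm_diskInvolution_le_one hb ?_
  rw [norm_pow]
  exact pow_le_one₀ (norm_nonneg _) (norm_diskInvolution_le_one ha hz)

theorem differentiableAt_powBlaschke (ha : |a| < 1) (hb : |b| < 1) {z : ℂ} (hz : ‖z‖ ≤ 1) :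
    DifferentiableAt ℂ (powBlaschke K a b) z := by
  have h : ‖diskInvolution a z ^ K‖ ≤ 1 := by
    rw [norm_pow]
    exact pow_le_one₀ (norm_nonneg _) (norm_diskInvolution_le_one ha hz)
  exact DifferentiableAt.comp z (differentiableAt_diskInvolution hb h)
    ((differentiableAt_diskInvolution ha hz).pow K)

theorem norm_iterate_powBlaschke_le_one (ha : |a| < 1) (hb : |b| < 1) (n : ℕ) {z : ℂ}
    (hz : ‖z‖ ≤ 1) : ‖(powBlaschke K a b)^[n] z‖ ≤ 1 := by
  induction n with
  | zero => simpa
  | succ n ih =>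
    rw [Function.iterate_succ_apply']
    exact norm_powBlaschke_le_one ha hb ih

theorem differentiableAt_iterate_powBlaschke (ha : |a| < 1) (hb : |b| < 1) (n : ℕ) {z : ℂ}
    (hz : ‖z‖ ≤ 1) : DifferentiableAt ℂ (powBlaschke K a b)^[n] z := by
  induction n with
  | zero => exact differentiableAt_id
  | succ n ih =>
    rw [Function.iterate_succ']
    exact DifferentiableAt.comp z
      (differentiableAt_powBlaschke ha hb (norm_iterate_powBlaschke_le_one ha hb n hz)) ih

theorem deriv_powBlaschke_self (hK : 2 ≤ K) (ha : |a| < 1) (hb : |b| < 1) :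
    deriv (powBlaschke K a b) a = 0 := by
  have hz : ‖(a : ℂ)‖ ≤ 1 := by simpa using ha.le
  have h0 : diskInvolution a a = 0 := by simp [diskInvolution]
  have hpow := (differentiableAt_diskInvolution ha hz).hasDerivAt.pow K
  have hzero : diskInvolution a a ^ K = 0 := by rw [h0]; exact zero_pow (by omega)
  have hout : HasDerivAt (diskInvolution b) (deriv (diskInvolution b) (diskInvolution a a ^ K))
      (diskInvolution a a ^ K) :=
    (differentiableAt_diskInvolution hb (by simp [hzero])).hasDerivAt
  have := (hout.comp (a : ℂ) hpow).deriv
  rw [h0, zero_pow (by omega : K - 1 ≠ 0), mul_zero, zero_mul, mul_zero] at this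
  exact this

/-- A non-injective Blaschke product fixing `0` contracts every smaller disk. -/
theorem exists_norm_powBlaschke_le_mul (hK : 2 ≤ K) (ha : |a| < 1) (hb : |b| < 1)
    (h0 : powBlaschke K a b 0 = 0) {r : ℝ} (hr : r < 1) :
    ∃ q < 1, 0 ≤ q ∧ ∀ z : ℂ, ‖z‖ ≤ r → ‖powBlaschke K a b z‖ ≤ q * ‖z‖ := by
  set f := powBlaschke K a b with hf
  have hd : DifferentiableOn ℂ f (Metric.ball 0 1) := fun z hz ↦
    (differentiableAt_powBlaschke ha hb (by simpa using (mem_ball_zero_iff.mp hz).le)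
      ).differentiableWithinAt
  have hmaps : Set.MapsTo f (Metric.ball 0 1) (Metric.closedBall (f 0) 1) := fun z hz ↦ by
    rw [h0, mem_closedBall_zero_iff]
    exact norm_powBlaschke_le_one ha hb (mem_ball_zero_iff.mp hz).le
  have hlt : ∀ z ∈ Metric.ball (0 : ℂ) 1, ‖dslope f 0 z‖ < 1 := by
    intro z hz
    refine lt_of_le_of_ne (by simpa using Complex.norm_dslope_le_div_of_mapsTo_ball hd hmaps hz) ?_
    intro heq
    have haff := Complex.affine_of_mapsTo_ball_of_norm_dslope_eq_div hd hmaps hz (by simpa using heq)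
    have hmem : (a : ℂ) ∈ Metric.ball (0 : ℂ) 1 := by simpa using ha
    have hder : deriv f a = dslope f 0 z := by
      rw [(haff.eventuallyEq_of_mem (Metric.isOpen_ball.mem_nhds hmem)).deriv_eq]
      simp [h0]
    rw [hf, deriv_powBlaschke_self hK ha hb] at hder
    rw [hf, ← hder] at heq
    simp at heq
  have hcont : ContinuousOn (dslope f 0) (Metric.closedBall 0 r) :=
    ((continuousOn_dslope (Metric.ball_mem_nhds 0 one_pos)).mpr
      ⟨hd.continuousOn, hd.differentiableAt (Metric.ball_mem_nhds 0 one_pos)⟩).mono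
      (Metric.closedBall_subset_ball hr)
  have hbound : ∀ q, (∀ z : ℂ, ‖z‖ ≤ r → ‖dslope f 0 z‖ ≤ q) →
      ∀ z : ℂ, ‖z‖ ≤ r → ‖f z‖ ≤ q * ‖z‖ := by
    intro q hq z hz
    have h := sub_smul_dslope f 0 z
    rw [h0, sub_zero, sub_zero] at h
    rw [← h, norm_smul, mul_comm]
    exact mul_le_mul_of_nonneg_right (hq z hz) (norm_nonneg z)
  rcases (Metric.closedBall (0 : ℂ) r).eq_empty_or_nonempty with he | hne
  · refine ⟨0, one_pos, le_rfl, fun z hz ↦ ?_⟩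
    exact absurd (mem_closedBall_zero_iff.mpr hz) (he ▸ Set.notMem_empty z)
  · obtain ⟨w, hw, hmax⟩ := (isCompact_closedBall (0 : ℂ) r).exists_isMaxOn hne hcont.norm
    exact ⟨‖dslope f 0 w‖, hlt w (Metric.closedBall_subset_ball hr hw), norm_nonneg _,
      hbound _ fun z hz ↦ hmax (mem_closedBall_zero_iff.mpr hz)⟩

theorem exists_norm_iterate_powBlaschke_le_pow (hK : 2 ≤ K) (ha : |a| < 1) (hb : |b| < 1)
    (h0 : powBlaschke K a b 0 = 0) {r : ℝ} (hr : r < 1) :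
    ∃ q < 1, 0 ≤ q ∧ ∀ (n : ℕ) (z : ℂ), ‖z‖ ≤ r → ‖(powBlaschke K a b)^[n] z‖ ≤ q ^ n := by
  obtain ⟨q, hq1, hq0, hq⟩ := exists_norm_powBlaschke_le_mul hK ha hb h0 hr
  refine ⟨q, hq1, hq0, fun n z hz ↦ ?_⟩
  suffices h : ‖(powBlaschke K a b)^[n] z‖ ≤ q ^ n * ‖z‖ from
    h.trans (mul_le_of_le_one_right (pow_nonneg hq0 n) (hz.trans hr.le))
  induction n with
  | zero => simp
  | succ n ih =>
    have hzr : ‖(powBlaschke K a b)^[n] z‖ ≤ r :=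
      ih.trans ((mul_le_of_le_one_left (norm_nonneg z) (pow_le_one₀ hq0 hq1.le)).trans hz)
    rw [Function.iterate_succ_apply', pow_succ', mul_assoc]
    exact (hq _ hzr).trans (mul_le_mul_of_nonneg_left ih hq0)

end powBlaschke

theorem exp_two_mul_arctan (y : ℝ) :
    Complex.exp ((2 * arctan y : ℝ) * Complex.I) =
      (1 + y * Complex.I) / (1 - y * Complex.I) := by
  have hc : (Complex.cos (arctan y)) ≠ 0 := by
    rw [← Complex.ofReal_cos]; exact_mod_cast (cos_arctan_pos y).ne'
  have hy : (y : ℂ) = Complex.sin (arctan y) / Complex.cos (arctan y) := by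
    rw [← Complex.ofReal_cos, ← Complex.ofReal_sin, ← Complex.ofReal_div, ← tan_eq_sin_div_cos,
      tan_arctan]
  have hne : (1 - y * Complex.I : ℂ) ≠ 0 := fun h ↦ by simpa using congrArg Complex.re h
  rw [eq_div_iff hne]
  have h1 : Complex.exp (-(arctan y * Complex.I)) =
      Complex.cos (arctan y) * (1 - y * Complex.I) := by
    rw [← neg_mul, Complex.exp_mul_I, Complex.cos_neg, Complex.sin_neg, hy]
    field_simp
    ring
  have h2 : Complex.exp (arctan y * Complex.I) =
      Complex.cos (arctan y) * (1 + y * Complex.I) := by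
    rw [Complex.exp_mul_I, hy]
    field_simp
  refine mul_left_cancel₀ hc ?_
  rw [mul_left_comm, ← h1, ← h2, ← Complex.exp_add]
  congr 1
  push_cast
  ring

theorem toCircle_cayleyAngle {γ : ℝ} (hγ : 0 < γ) (x : ℝ) :
    ((cayleyAngle γ x).toCircle : ℂ) = cayley γ x := by
  rw [cayleyAngle, AddCircle.toCircle_apply_mk, Circle.coe_exp, cayley]
  have hγ' : (γ : ℂ) ≠ 0 := by exact_mod_cast hγ.ne'
  rw [div_self two_pi_pos.ne', one_mul, exp_two_mul_arctan]
  push_cast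
  rw [← mul_div_mul_left _ _ hγ']
  congr 1 <;> field_simp

theorem ofReal_sub_mul_I_ne_zero {γ : ℝ} (hγ : γ ≠ 0) (x : ℝ) :
    (γ - x * Complex.I : ℂ) ≠ 0 := fun h ↦ hγ (by simpa using congrArg Complex.re h)

theorem diskInvolution_cayley {γ : ℝ} (hγ : 0 < γ) (x : ℝ) :
    diskInvolution ((γ - 1) / (γ + 1)) (cayley γ x) = (x - Complex.I) / (x + Complex.I) := by
  have h1 : (γ + 1 : ℂ) ≠ 0 := by exact_mod_cast (by positivity : γ + 1 ≠ 0)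
  have h2 := ofReal_sub_mul_I_ne_zero hγ.ne' x
  have h3 : (x + Complex.I : ℂ) ≠ 0 := fun h ↦ by simpa using congrArg Complex.im h
  have h4 : (γ + 1) * (γ - x * Complex.I) - (γ - 1) * (γ + x * Complex.I) ≠ (0 : ℂ) := by
    have : (γ + 1) * (γ - x * Complex.I) - (γ - 1) * (γ + x * Complex.I) =
        -2 * γ * Complex.I * (x + Complex.I) := by
      linear_combination (2 * γ) * Complex.I_sq
    rw [this]
    have hγ' : (γ : ℂ) ≠ 0 := by exact_mod_cast hγ.ne'
    simp [hγ', h3]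
  rw [diskInvolution, cayley]
  push_cast
  have h5 : 1 - ((γ : ℂ) - 1) / (γ + 1) * ((γ + x * Complex.I) / (γ - x * Complex.I)) =
      ((γ + 1) * (γ - x * Complex.I) - (γ - 1) * (γ + x * Complex.I)) /
        ((γ + 1) * (γ - x * Complex.I)) := by
    field_simp
  have h6 : ((γ : ℂ) - 1) / (γ + 1) - ((γ + x * Complex.I) / (γ - x * Complex.I)) =
      ((γ - 1) * (γ - x * Complex.I) - (γ + 1) * (γ + x * Complex.I)) /
        ((γ + 1) * (γ - x * Complex.I)) := by
    field_simp
  rw [h5, h6, div_div_div_cancel_right₀ (mul_ne_zero h1 h2), div_eq_div_iff h4 h3]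
  ring_nf
  simp only [Complex.I_sq]
  ring

theorem div_eq_exp_arccot (x : ℝ) :
    (x - Complex.I) / (x + Complex.I) = Complex.exp (-2 * arccot' x * Complex.I) := by
  have h3 : (x + Complex.I : ℂ) ≠ 0 := fun h ↦ by simpa using congrArg Complex.im h
  have h4 : (1 - x * Complex.I : ℂ) ≠ 0 := fun h ↦ by simpa using congrArg Complex.re h
  have h : (-2 * arccot' x * Complex.I : ℂ) =
      (2 * arctan x : ℝ) * Complex.I - π * Complex.I := by
    rw [arccot']; push_cast; ring
  rw [h, Complex.exp_sub, Complex.exp_pi_mul_I, exp_two_mul_arctan, div_neg, div_one, ← neg_div,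
    div_eq_div_iff h3 h4]
  linear_combination (2 * x) * Complex.I_sq

theorem diskInvolution_exp {γ β : ℝ} (hγ : 0 < γ) (hβ : 0 < β) {u : ℝ} (hu : sin u ≠ 0) :
    diskInvolution ((γ - β) / (γ + β)) (Complex.exp (-2 * u * Complex.I)) =
      cayley γ (β * cot' u) := by
  have h1 : (γ + β : ℂ) ≠ 0 := by exact_mod_cast (by positivity : γ + β ≠ 0)
  have hs : Complex.sin u ≠ 0 := by rw [← Complex.ofReal_sin]; exact_mod_cast hu
  have h2 : (γ * Complex.sin u - β * Complex.cos u * Complex.I : ℂ) ≠ 0 := by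
    have := ofReal_sub_mul_I_ne_zero (mul_ne_zero hγ.ne' hu) (β * cos u)
    push_cast at this
    exact this
  have hw : Complex.exp (-2 * u * Complex.I) =
      (Complex.cos u - Complex.sin u * Complex.I) / (Complex.cos u + Complex.sin u * Complex.I) := by
    rw [← Complex.exp_mul_I, eq_div_iff (Complex.exp_ne_zero _), ← Complex.exp_add]
    have := Complex.exp_mul_I (-(u : ℂ))
    rw [Complex.cos_neg, Complex.sin_neg] at this
    rw [sub_eq_add_neg, ← neg_mul, ← this]
    congr 1
    ring
  have h3 : Complex.cos u + Complex.sin u * Complex.I ≠ 0 := by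
    rw [← Complex.exp_mul_I]; exact Complex.exp_ne_zero _
  have hrhs : cayley γ (β * cot' u) =
      (γ * Complex.sin u + β * Complex.cos u * Complex.I) /
        (γ * Complex.sin u - β * Complex.cos u * Complex.I) := by
    rw [cayley, cot', ← mul_div_mul_left _ _ hs]
    push_cast
    congr 1 <;> field_simp
  set C := Complex.cos u
  set s := Complex.sin u
  have h4 : (γ + β) * (C + s * Complex.I) - (γ - β) * (C - s * Complex.I) ≠ (0 : ℂ) := by
    have : (γ + β) * (C + s * Complex.I) - (γ - β) * (C - s * Complex.I) =
        2 * Complex.I * (γ * s - β * C * Complex.I) := by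
      linear_combination (2 * β * C) * Complex.I_sq
    rw [this]
    simp [h2]
  have h5 : 1 - ((γ : ℂ) - β) / (γ + β) * ((C - s * Complex.I) / (C + s * Complex.I)) =
      ((γ + β) * (C + s * Complex.I) - (γ - β) * (C - s * Complex.I)) /
        ((γ + β) * (C + s * Complex.I)) := by
    field_simp
  have h6 : ((γ : ℂ) - β) / (γ + β) - (C - s * Complex.I) / (C + s * Complex.I) =
      ((γ - β) * (C + s * Complex.I) - (γ + β) * (C - s * Complex.I)) /
        ((γ + β) * (C + s * Complex.I)) := by
    field_simp
  rw [hrhs, diskInvolution, hw]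
  push_cast
  rw [h5, h6, div_div_div_cancel_right₀ (mul_ne_zero h1 h3), div_eq_div_iff h4 h2]
  ring_nf
  simp only [Complex.I_sq]
  ring

/-- The Cayley transform semiconjugates the SGB map to a Blaschke product. -/
theorem cayley_SGB {K : ℕ} {α γ : ℝ} (hγ : 0 < γ) (hβ : 0 < α * K) {x : ℝ}
    (hx : sin (K * arccot' x) ≠ 0) :
    cayley γ (SGB K α x) =
      powBlaschke K ((γ - 1) / (γ + 1)) ((γ - α * K) / (γ + α * K)) (cayley γ x) := by
  rw [powBlaschke, diskInvolution_cayley hγ, div_eq_exp_arccot, ← Complex.exp_nat_mul, SGB,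
    ← diskInvolution_exp hγ hβ hx]
  congr 2
  push_cast
  ring

theorem abs_sub_div_add_lt_one {γ β : ℝ} (hγ : 0 < γ) (hβ : 0 < β) :
    |(γ - β) / (γ + β)| < 1 := by
  rw [abs_div, abs_of_pos (add_pos hγ hβ), div_lt_one (add_pos hγ hβ), abs_sub_lt_iff]
  constructor <;> linarith

instance two_pi_pos_fact : Fact (0 < 2 * π) := ⟨two_pi_pos⟩

theorem measurable_SGB (K : ℕ) (α : ℝ) : Measurable (SGB K α) := by
  unfold SGB cot' arccot'
  fun_prop

theorem hasDerivAt_two_mul_arctan_div {γ : ℝ} (hγ : 0 < γ) (x : ℝ) :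
    HasDerivAt (fun x ↦ 2 * arctan (x / γ)) (2 * π * (γ / (π * (x ^ 2 + γ ^ 2)))) x := by
  refine (((hasDerivAt_id' x).div_const γ).arctan.const_mul 2).congr_deriv ?_
  have := pi_ne_zero
  field_simp
  ring

theorem two_mul_arctan_div_injective {γ : ℝ} (hγ : 0 < γ) :
    Function.Injective fun x ↦ 2 * arctan (x / γ) := by
  intro x y h
  have h' := arctan_injective (mul_left_cancel₀ two_ne_zero h)
  rwa [div_left_inj' hγ.ne'] at h'

theorem range_two_mul_arctan_div {γ : ℝ} (hγ : 0 < γ) :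
    Set.range (fun x ↦ 2 * arctan (x / γ)) = Set.Ioo (-π) π := by
  ext t
  constructor
  · rintro ⟨x, rfl⟩
    constructor <;> dsimp only <;>
      linarith [arctan_lt_pi_div_two (x / γ), neg_pi_div_two_lt_arctan (x / γ)]
  · rintro ⟨h1, h2⟩
    refine ⟨γ * tan (t / 2), ?_⟩
    dsimp only
    rw [mul_div_cancel_left₀ _ hγ.ne', arctan_tan (by linarith) (by linarith)]
    ring

theorem map_two_mul_arctan_div {γ : ℝ} (hγ : 0 < γ) :
    Measure.map (fun x ↦ 2 * arctan (x / γ)) (cauchyMeasure γ) =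
      (ENNReal.ofReal (2 * π))⁻¹ • volume.restrict (Set.Ioc (-π) π) := by
  have hm : Measurable fun x ↦ 2 * arctan (x / γ) := by fun_prop
  have h0 : ENNReal.ofReal (2 * π) ≠ 0 := by simpa using pi_pos
  ext s hs
  have hpre := hm hs
  have hvol := lintegral_image_eq_lintegral_abs_deriv_mul hpre
    (fun x _ ↦ (hasDerivAt_two_mul_arctan_div hγ x).hasDerivWithinAt)
    (two_mul_arctan_div_injective hγ).injOn (fun _ ↦ 1)
  rw [Set.image_preimage_eq_inter_range, range_two_mul_arctan_div hγ, setLIntegral_one] at hvol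
  rw [Measure.map_apply hm hs, cauchyMeasure, withDensity_apply _ hpre, Measure.smul_apply,
    Measure.restrict_congr_set Ioo_ae_eq_Ioc.symm, Measure.restrict_apply hs, hvol, smul_eq_mul,
    ← lintegral_const_mul _ (by fun_prop)]
  refine lintegral_congr fun x ↦ ?_
  rw [mul_one, abs_of_nonneg (by positivity), ENNReal.ofReal_mul two_pi_pos.le, ← mul_assoc,
    ENNReal.inv_mul_cancel h0 ENNReal.ofReal_ne_top, one_mul]

theorem measurePreserving_cayleyAngle {γ : ℝ} (hγ : 0 < γ) :
    MeasurePreserving (cayleyAngle γ) (cauchyMeasure γ) AddCircle.haarAddCircle := by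
  have hT : ENNReal.ofReal (2 * π) ≠ 0 := by simpa using pi_pos
  have h1 : MeasurePreserving (fun x ↦ 2 * arctan (x / γ)) (cauchyMeasure γ)
      ((ENNReal.ofReal (2 * π))⁻¹ • volume.restrict (Set.Ioc (-π) π)) :=
    ⟨by fun_prop, map_two_mul_arctan_div hγ⟩
  have h2 := (AddCircle.measurePreserving_mk (2 * π) (-π)).smul_measure
    (ENNReal.ofReal (2 * π))⁻¹
  rw [AddCircle.volume_eq_smul_haarAddCircle, smul_smul,
    ENNReal.inv_mul_cancel hT ENNReal.ofReal_ne_top, one_smul,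
    show -π + 2 * π = π by ring] at h2
  exact h2.comp h1

theorem isProbabilityMeasure_cauchyMeasure {γ : ℝ} (hγ : 0 < γ) :
    IsProbabilityMeasure (cauchyMeasure γ) :=
  ⟨by simpa using
    (measurePreserving_cayleyAngle hγ).measure_preimage MeasurableSet.univ.nullMeasurableSet⟩

theorem cayleyAngle_injective {γ : ℝ} (hγ : 0 < γ) : Function.Injective (cayleyAngle γ) := by
  intro x y h
  refine two_mul_arctan_div_injective hγ ?_
  have hmem : ∀ x : ℝ, 2 * arctan (x / γ) ∈ Set.Ico (-π) (-π + 2 * π) := fun x ↦ by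
    have := (range_two_mul_arctan_div hγ).subset (Set.mem_range_self x)
    exact ⟨this.1.le, by linarith [this.2]⟩
  exact (AddCircle.coe_eq_coe_iff_of_mem_Ico (hmem x) (hmem y)).mp h

theorem measurableEmbedding_cayleyAngle {γ : ℝ} (hγ : 0 < γ) :
    MeasurableEmbedding (cayleyAngle γ) :=
  (measurePreserving_cayleyAngle hγ).measurable.measurableEmbedding (cayleyAngle_injective hγ)

theorem continuous_cayley {γ : ℝ} (hγ : 0 < γ) : Continuous (cayley γ) := by
  unfold cayley
  exact Continuous.div (by fun_prop) (by fun_prop) (ofReal_sub_mul_I_ne_zero hγ.ne')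

/-- Integration against the Cauchy measure is averaging over the unit circle. -/
theorem integral_comp_cayley {γ : ℝ} (hγ : 0 < γ) (F : ℂ → ℂ)
    (hF : ContinuousOn F (Metric.sphere 0 1)) :
    ∫ x, F (cayley γ x) ∂cauchyMeasure γ = circleAverage F 0 1 := by
  have hcont : Continuous fun t : AddCircle (2 * π) ↦ F t.toCircle :=
    hF.comp_continuous (by fun_prop)
      fun t ↦ by rw [mem_sphere_zero_iff_norm, Circle.norm_coe]
  have h := integral_map (measurePreserving_cayleyAngle hγ).measurable.aemeasurable
    (μ := cauchyMeasure γ) (f := fun t ↦ F t.toCircle) hcont.aestronglyMeasurable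
  rw [(measurePreserving_cayleyAngle hγ).map_eq] at h
  simp only [toCircle_cayleyAngle hγ] at h
  rw [← h, AddCircle.integral_haarAddCircle, circleAverage,
    ← AddCircle.intervalIntegral_preimage (2 * π) 0]
  simp [AddCircle.toCircle_apply_mk, circleMap]

theorem circleAverage_eq_of_differentiableAt {f : ℂ → ℂ}
    (hf : ∀ z : ℂ, z ≠ 0 → ‖z‖ ≤ 1 → DifferentiableAt ℂ f z) {r : ℝ} (hr0 : 0 < r) (hr1 : r ≤ 1) :
    circleAverage f 0 1 = circleAverage f 0 r := by
  rw [circleAverage_eq_circleIntegral one_ne_zero, circleAverage_eq_circleIntegral hr0.ne']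
  congr 1
  refine Complex.circleIntegral_sub_center_inv_smul_eq_of_differentiable_on_annulus_off_countable
    hr0 hr1 Set.countable_empty (fun z hz ↦ (hf z ?_ ?_).continuousAt.continuousWithinAt)
    (fun z hz ↦ hf z ?_ ?_)
  · rintro rfl
    exact hz.2 (Metric.mem_ball_self hr0)
  · simpa using hz.1
  · rintro rfl
    exact hz.1.2 (Metric.mem_closedBall_self hr0.le)
  · simpa using (mem_ball_zero_iff.mp hz.1.1).le

theorem norm_circleAverage_le {f : ℂ → ℂ} {c : ℂ} {R C : ℝ}
    (hf : ∀ z ∈ Metric.sphere c |R|, ‖f z‖ ≤ C) : ‖circleAverage f c R‖ ≤ C := by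
  have h := intervalIntegral.norm_integral_le_of_norm_le_const (a := 0) (b := 2 * π)
    (f := fun θ ↦ f (circleMap c R θ)) (C := C) fun θ _ ↦ hf _ (circleMap_mem_sphere' c R θ)
  rw [sub_zero, abs_of_pos two_pi_pos] at h
  rw [circleAverage, norm_smul, norm_inv, norm_of_nonneg two_pi_pos.le, inv_mul_le_iff₀ two_pi_pos,
    mul_comm _ C]
  exact h

theorem tendsto_circleAverage_zpow_mul_iterate {K : ℕ} {a b : ℝ} (hK : 2 ≤ K) (ha : |a| < 1)
    (hb : |b| < 1) (h0 : powBlaschke K a b 0 = 0) (k : ℤ) {m : ℕ} (hm : m ≠ 0) :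
    Tendsto (fun n : ℕ ↦ circleAverage (fun z ↦ z ^ k * ((powBlaschke K a b)^[n] z) ^ m) 0 1)
      atTop (nhds 0) := by
  obtain ⟨q, hq1, hq0, hq⟩ :=
    exists_norm_iterate_powBlaschke_le_pow hK ha hb h0 (by norm_num : (1 / 2 : ℝ) < 1)
  have hlim : Tendsto (fun n : ℕ ↦ (1 / 2 : ℝ) ^ k * q ^ n) atTop (nhds 0) := by
    simpa using (tendsto_pow_atTop_nhds_zero_of_lt_one hq0 hq1).const_mul ((1 / 2 : ℝ) ^ k)
  refine squeeze_zero_norm (fun n ↦ ?_) hlim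
  have hd : ∀ z : ℂ, z ≠ 0 → ‖z‖ ≤ 1 →
      DifferentiableAt ℂ (fun z ↦ z ^ k * ((powBlaschke K a b)^[n] z) ^ m) z := fun z hz hz1 ↦
    (differentiableAt_zpow.mpr (Or.inl hz)).mul
      ((differentiableAt_iterate_powBlaschke ha hb n hz1).pow m)
  rw [circleAverage_eq_of_differentiableAt hd (by norm_num : (0 : ℝ) < 1 / 2) (by norm_num)]
  refine norm_circleAverage_le fun z hz ↦ ?_
  have hz' : ‖z‖ = 1 / 2 := by simpa using hz
  rw [norm_mul, norm_zpow, norm_pow, hz']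
  refine mul_le_mul_of_nonneg_left ?_ (by positivity)
  exact (pow_le_of_le_one (norm_nonneg _) (norm_iterate_powBlaschke_le_one ha hb n
    (hz'.le.trans (by norm_num))) hm).trans (hq n z hz'.le)

theorem powBlaschke_zero_eq_zero {K : ℕ} {a b γ : ℝ} (ha : |a| < 1) (hb : |b| < 1) (hγ : 0 < γ)
    {S : ℝ → ℝ} (hS : MeasurePreserving S (cauchyMeasure γ) (cauchyMeasure γ))
    (hsemi : ∀ᵐ x ∂cauchyMeasure γ, cayley γ (S x) = powBlaschke K a b (cayley γ x)) :
    powBlaschke K a b 0 = 0 := by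
  have hd : ∀ z : ℂ, ‖z‖ ≤ 1 → DifferentiableAt ℂ (powBlaschke K a b) z := fun z hz ↦
    differentiableAt_powBlaschke ha hb hz
  have hmean : ∀ F : ℂ → ℂ, (∀ z : ℂ, ‖z‖ ≤ 1 → DifferentiableAt ℂ F z) →
      ∫ x, F (cayley γ x) ∂cauchyMeasure γ = F 0 := fun F hF ↦ by
    rw [integral_comp_cayley hγ F fun z hz ↦ (hF z (by simpa using
      (mem_sphere_zero_iff_norm.mp hz).le)).continuousAt.continuousWithinAt]
    exact DiffContOnCl.circleAverage (DifferentiableOn.diffContOnCl fun z hz ↦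
      (hF z (by simpa using Metric.closure_ball_subset_closedBall hz)).differentiableWithinAt)
  have h1 := hmean _ hd
  have h2 := hmean id fun z _ ↦ differentiableAt_id
  have h3 := integral_map hS.measurable.aemeasurable (f := cayley γ) (μ := cauchyMeasure γ)
    (continuous_cayley hγ).aestronglyMeasurable
  rw [hS.map_eq, integral_congr_ae hsemi, h1] at h3
  rw [← h3]
  exact h2

theorem ae_sin_mul_arccot_ne_zero {K : ℕ} (hK : K ≠ 0) (γ : ℝ) :
    ∀ᵐ x ∂cauchyMeasure γ, sin (K * arccot' x) ≠ 0 := by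
  refine (withDensity_absolutelyContinuous _ _).ae_le ?_
  have hK' : (K : ℝ) ≠ 0 := by exact_mod_cast hK
  have hinj : Function.Injective fun x ↦ K * arccot' x := by
    intro x y h
    have h' := mul_left_cancel₀ hK' h
    simp only [arccot', sub_right_inj] at h'
    exact arctan_injective h'
  have hcount : {x | sin (K * arccot' x) = 0}.Countable := by
    refine Set.Countable.mono (fun x hx ↦ ?_)
      ((Set.countable_range fun n : ℤ ↦ (n : ℝ) * π).preimage hinj)
    exact sin_eq_zero_iff.mp hx
  exact hcount.ae_notMem volume

theorem ae_cayley_iterate {γ : ℝ} {S : ℝ → ℝ} {f : ℂ → ℂ}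
    (hS : MeasurePreserving S (cauchyMeasure γ) (cauchyMeasure γ))
    (hsemi : ∀ᵐ x ∂cauchyMeasure γ, cayley γ (S x) = f (cayley γ x)) (n : ℕ) :
    ∀ᵐ x ∂cauchyMeasure γ, cayley γ (S^[n] x) = f^[n] (cayley γ x) := by
  induction n with
  | zero => simp
  | succ n ih =>
    filter_upwards [hS.quasiMeasurePreserving.ae ih, hsemi] with x hx hx'
    rw [Function.iterate_succ_apply, Function.iterate_succ_apply, hx, hx']

theorem tendsto_integral_zpow_mul_pow {K : ℕ} {a b γ : ℝ} (hK : 2 ≤ K) (ha : |a| < 1)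
    (hb : |b| < 1) (hγ : 0 < γ) {S : ℝ → ℝ}
    (hS : MeasurePreserving S (cauchyMeasure γ) (cauchyMeasure γ))
    (hsemi : ∀ᵐ x ∂cauchyMeasure γ, cayley γ (S x) = powBlaschke K a b (cayley γ x))
    (k : ℤ) {m : ℕ} (hm : m ≠ 0) :
    Tendsto (fun n : ℕ ↦ ∫ x, cayley γ x ^ k * cayley γ (S^[n] x) ^ m ∂cauchyMeasure γ)
      atTop (nhds 0) := by
  refine (tendsto_circleAverage_zpow_mul_iterate hK ha hb
    (powBlaschke_zero_eq_zero ha hb hγ hS hsemi) k hm).congr fun n ↦ ?_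
  rw [← integral_comp_cayley hγ]
  · refine integral_congr_ae ?_
    filter_upwards [ae_cayley_iterate hS hsemi n] with x hx
    rw [hx]
  · intro z hz
    have hz1 : ‖z‖ = 1 := mem_sphere_zero_iff_norm.mp hz
    exact ((continuousAt_zpow₀ z k (Or.inl (norm_ne_zero_iff.mp (by simp [hz1])))).mul
      ((differentiableAt_iterate_powBlaschke ha hb n hz1.le).continuousAt.pow m)
      ).continuousWithinAt

/-- A bounded sequence of linear functionals tending to `0` on a set with dense span tends to `0`
everywhere. -/
theorem tendsto_zero_of_dense_span {E : Type*} [NormedAddCommGroup E] [NormedSpace ℂ E]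
    {s : Set E} (hs : (Submodule.span ℂ s).topologicalClosure = ⊤) {L : ℕ → E →ₗ[ℂ] ℂ} {C : ℝ}
    (hL : ∀ n x, ‖L n x‖ ≤ C * ‖x‖) (hlim : ∀ x ∈ s, Tendsto (fun n ↦ L n x) atTop (nhds 0))
    (x : E) : Tendsto (fun n ↦ L n x) atTop (nhds 0) := by
  have hspan : ∀ y ∈ Submodule.span ℂ s, Tendsto (fun n ↦ L n y) atTop (nhds 0) := by
    intro y hy
    induction hy using Submodule.span_induction with
    | mem y hy => exact hlim y hy
    | zero => simp
    | add y z _ _ hy hz => simpa using hy.add hz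
    | smul c y _ hy => simpa using hy.const_mul c
  have hx : x ∈ closure (Submodule.span ℂ s : Set E) := by
    rw [← Submodule.topologicalClosure_coe, hs]
    exact Submodule.mem_top
  have hC : 0 < |C| + 1 := by positivity
  rw [Metric.tendsto_atTop]
  intro ε hε
  obtain ⟨y, hy, hxy⟩ := Metric.mem_closure_iff.mp hx (ε / 2 / (|C| + 1)) (by positivity)
  obtain ⟨N, hN⟩ := Metric.tendsto_atTop.mp (hspan y hy) (ε / 2) (by positivity)
  refine ⟨N, fun n hn ↦ ?_⟩
  have h1 := hN n hn
  rw [dist_zero_right] at h1 ⊢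
  rw [dist_eq_norm, lt_div_iff₀ hC] at hxy
  have h2 : ‖L n (x - y)‖ ≤ (|C| + 1) * ‖x - y‖ :=
    (hL n _).trans (mul_le_mul_of_nonneg_right (by linarith [le_abs_self C]) (norm_nonneg _))
  calc ‖L n x‖ = ‖L n (x - y) + L n y‖ := by rw [map_sub, sub_add_cancel]
    _ ≤ ‖L n (x - y)‖ + ‖L n y‖ := norm_add_le _ _
    _ < ε := by linarith

/-- Decay of correlations along isometries only has to be checked on a set with dense span. -/
theorem tendsto_inner_of_dense_span {E F : Type*} [NormedAddCommGroup E] [InnerProductSpace ℂ E]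
    [NormedAddCommGroup F] [InnerProductSpace ℂ F] {s : Set E}
    (hs : (Submodule.span ℂ s).topologicalClosure = ⊤) (J : E →ₗᵢ[ℂ] F) (U : ℕ → F →ₗᵢ[ℂ] F)
    (e : F)
    (hlim : ∀ x ∈ s, ∀ y ∈ s, Tendsto
      (fun n ↦ inner ℂ (J y) (U n (J x)) - inner ℂ (J y) e * inner ℂ e (J x)) atTop (nhds 0))
    (x y : E) : Tendsto
      (fun n ↦ inner ℂ (J y) (U n (J x)) - inner ℂ (J y) e * inner ℂ e (J x)) atTop (nhds 0) := by
  have hbound : ∀ n x y, ‖inner ℂ (J y) (U n (J x)) - inner ℂ (J y) e * inner ℂ e (J x)‖ ≤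
      (1 + ‖e‖ ^ 2) * ‖y‖ * ‖x‖ := by
    intro n x y
    have h1 := norm_inner_le_norm (𝕜 := ℂ) (J y) (U n (J x))
    have h2 := norm_inner_le_norm (𝕜 := ℂ) (J y) e
    have h3 := norm_inner_le_norm (𝕜 := ℂ) e (J x)
    have h4 := mul_le_mul h2 h3 (norm_nonneg _) (by positivity)
    rw [LinearIsometry.norm_map, LinearIsometry.norm_map, LinearIsometry.norm_map] at h1
    rw [LinearIsometry.norm_map, LinearIsometry.norm_map] at h4
    refine (norm_sub_le _ _).trans ?_
    rw [norm_mul]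
    linarith
  have hleft : ∀ x : E, ∀ y ∈ s, Tendsto
      (fun n ↦ inner ℂ (J y) (U n (J x)) - inner ℂ (J y) e * inner ℂ e (J x)) atTop (nhds 0) :=
    fun x y hy ↦ tendsto_zero_of_dense_span hs
      (L := fun n ↦
        { toFun := fun x ↦ inner ℂ (J y) (U n (J x)) - inner ℂ (J y) e * inner ℂ e (J x)
          map_add' := fun u v ↦ by simp only [map_add, inner_add_right]; ring
          map_smul' := fun c u ↦ by
            simp only [map_smul, inner_smul_right, smul_eq_mul, RingHom.id_apply]; ring })
      (fun n x ↦ hbound n x y) (fun x hx ↦ hlim x hx y hy) x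
  have hright : ∀ y : E, Tendsto
      (fun n ↦ inner ℂ (U n (J x)) (J y) - inner ℂ e (J y) * inner ℂ (J x) e) atTop (nhds 0) := by
    have hconj : ∀ n y, inner ℂ (U n (J x)) (J y) - inner ℂ e (J y) * inner ℂ (J x) e =
        starRingEnd ℂ (inner ℂ (J y) (U n (J x)) - inner ℂ (J y) e * inner ℂ e (J x)) := by
      intro n y
      rw [map_sub, map_mul, inner_conj_symm, inner_conj_symm, inner_conj_symm]
    refine fun y ↦ tendsto_zero_of_dense_span hs (C := (1 + ‖e‖ ^ 2) * ‖x‖)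
      (L := fun n ↦
        { toFun := fun y ↦ inner ℂ (U n (J x)) (J y) - inner ℂ e (J y) * inner ℂ (J x) e
          map_add' := fun u v ↦ by simp only [map_add, inner_add_right]; ring
          map_smul' := fun c u ↦ by
            simp only [map_smul, inner_smul_right, smul_eq_mul, RingHom.id_apply]; ring })
      (fun n y ↦ ?_) (fun y hy ↦ ?_) y
    · simp only [LinearMap.coe_mk, AddHom.coe_mk]
      rw [hconj, RCLike.norm_conj, mul_right_comm]
      exact hbound n x y
    · simp only [LinearMap.coe_mk, AddHom.coe_mk, hconj]
      have h := (Complex.continuous_conj.tendsto _).comp (hleft x y hy)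
      rwa [map_zero] at h
  have h := (Complex.continuous_conj.tendsto _).comp (hright y)
  rw [map_zero] at h
  refine h.congr fun n ↦ ?_
  simp only [Function.comp_apply, map_sub, map_mul, inner_conj_symm]

theorem fourier_cayleyAngle {γ : ℝ} (hγ : 0 < γ) (k : ℤ) (x : ℝ) :
    fourier k (cayleyAngle γ x) = cayley γ x ^ k := by
  rw [fourier_apply, AddCircle.toCircle_zsmul, Circle.coe_zpow, toCircle_cayleyAngle hγ]

theorem conj_cayley {γ : ℝ} (hγ : 0 < γ) (x : ℝ) :
    starRingEnd ℂ (cayley γ x) = (cayley γ x)⁻¹ := by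
  rw [← toCircle_cayleyAngle hγ, ← Circle.coe_inv, Circle.coe_inv_eq_conj]

/-- Decay of correlations of characters of the circle, for every pair of frequencies. -/
theorem tendsto_integral_zpow_mul_zpow {K : ℕ} {a b γ : ℝ} (hK : 2 ≤ K) (ha : |a| < 1)
    (hb : |b| < 1) (hγ : 0 < γ) {S : ℝ → ℝ}
    (hS : MeasurePreserving S (cauchyMeasure γ) (cauchyMeasure γ))
    (hsemi : ∀ᵐ x ∂cauchyMeasure γ, cayley γ (S x) = powBlaschke K a b (cayley γ x))
    (k : ℤ) {j : ℤ} (hj : j ≠ 0) :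
    Tendsto (fun n : ℕ ↦ ∫ x, cayley γ x ^ k * cayley γ (S^[n] x) ^ j ∂cauchyMeasure γ)
      atTop (nhds 0) := by
  obtain ⟨m, rfl | rfl⟩ := j.eq_nat_or_neg
  · simpa using tendsto_integral_zpow_mul_pow hK ha hb hγ hS hsemi k (by simpa using hj)
  · have h := (Complex.continuous_conj.tendsto _).comp
      (tendsto_integral_zpow_mul_pow hK ha hb hγ hS hsemi (-k) (m := m) (by simpa using hj))
    rw [map_zero] at h
    refine h.congr fun n ↦ ?_
    simp only [Function.comp_apply]
    rw [← integral_conj]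
    simp [conj_cayley hγ]

/-- The Koopman isometry of a measure preserving map on complex `L²`. -/
noncomputable abbrev koopman {X Y : Type*} [MeasurableSpace X] [MeasurableSpace Y] {μ : Measure X}
    {ν : Measure Y} {T : X → Y} (hT : MeasurePreserving T μ ν) : Lp ℂ 2 ν →ₗᵢ[ℂ] Lp ℂ 2 μ :=
  Lp.compMeasurePreservingₗᵢ ℂ T hT

/-- The indicator function of a measurable set as an element of complex `L²`. -/
noncomputable abbrev indicatorL2 {X : Type*} [MeasurableSpace X] (μ : Measure X)
    [IsFiniteMeasure μ] {s : Set X} (hs : MeasurableSet s) : Lp ℂ 2 μ :=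
  indicatorConstLp 2 hs (measure_ne_top μ s) 1

theorem koopman_indicatorL2 {X Y : Type*} [MeasurableSpace X] [MeasurableSpace Y] {μ : Measure X}
    {ν : Measure Y} [IsFiniteMeasure μ] [IsFiniteMeasure ν] {T : X → Y}
    (hT : MeasurePreserving T μ ν) {s : Set Y} (hs : MeasurableSet s) :
    koopman hT (indicatorL2 ν hs) = indicatorL2 μ (hT.measurable hs) :=
  Lp.indicatorConstLp_compMeasurePreserving hs (measure_ne_top ν s) (1 : ℂ) hT

theorem inner_indicatorL2 {X : Type*} [MeasurableSpace X] (μ : Measure X) [IsFiniteMeasure μ]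
    {s t : Set X} (hs : MeasurableSet s) (ht : MeasurableSet t) :
    inner ℂ (indicatorL2 μ hs) (indicatorL2 μ ht) = (μ.real (s ∩ t) : ℂ) := by
  rw [L2.inner_indicatorConstLp_indicatorConstLp]
  simp

theorem koopman_fourierLp {γ : ℝ} (hγ : 0 < γ) (k : ℤ) :
    koopman (measurePreserving_cayleyAngle hγ) (fourierLp 2 k) =ᵐ[cauchyMeasure γ]
      fun x ↦ cayley γ x ^ k := by
  have hΨ := measurePreserving_cayleyAngle hγ
  filter_upwards [Lp.coeFn_compMeasurePreserving (fourierLp 2 k) hΨ,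
    hΨ.quasiMeasurePreserving.ae_eq_comp (coeFn_fourierLp 2 k)] with x h1 h2
  exact (h1.trans h2).trans (fourier_cayleyAngle hγ k x)

theorem koopman_fourierLp_zero {γ : ℝ} (hγ : 0 < γ) [IsFiniteMeasure (cauchyMeasure γ)] :
    koopman (measurePreserving_cayleyAngle hγ) (fourierLp 2 0) =
      indicatorL2 (cauchyMeasure γ) MeasurableSet.univ := by
  refine Lp.ext ?_
  filter_upwards [koopman_fourierLp hγ 0, indicatorConstLp_coeFn (p := 2)
    (hs := MeasurableSet.univ) (hμs := measure_ne_top (cauchyMeasure γ) _) (c := (1 : ℂ))]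
    with x h1 h2
  rw [h1, h2]
  simp

theorem inner_koopman_fourierLp {γ : ℝ} (hγ : 0 < γ) {T : ℝ → ℝ}
    (hT : MeasurePreserving T (cauchyMeasure γ) (cauchyMeasure γ)) (k j : ℤ) :
    inner ℂ (koopman (measurePreserving_cayleyAngle hγ) (fourierLp 2 k))
        (koopman hT (koopman (measurePreserving_cayleyAngle hγ) (fourierLp 2 j))) =
      ∫ x, cayley γ x ^ (-k) * cayley γ (T x) ^ j ∂cauchyMeasure γ := by
  rw [L2.inner_def]
  refine integral_congr_ae ?_
  filter_upwards [koopman_fourierLp hγ k, Lp.coeFn_compMeasurePreserving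
    (koopman (measurePreserving_cayleyAngle hγ) (fourierLp 2 j)) hT,
    hT.quasiMeasurePreserving.ae_eq_comp (koopman_fourierLp hγ j)] with x h1 h2 h3
  have h4 : (koopman hT (koopman (measurePreserving_cayleyAngle hγ) (fourierLp 2 j)) : ℝ → ℂ) x =
      cayley γ (T x) ^ j := h2.trans h3
  rw [h1, h4, RCLike.inner_apply', map_zpow₀, conj_cayley hγ, inv_zpow']

theorem tendsto_inner_koopman_iterate {K : ℕ} {a b γ : ℝ} (hK : 2 ≤ K) (ha : |a| < 1)
    (hb : |b| < 1) (hγ : 0 < γ) [IsFiniteMeasure (cauchyMeasure γ)] {S : ℝ → ℝ}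
    (hS : MeasurePreserving S (cauchyMeasure γ) (cauchyMeasure γ))
    (hsemi : ∀ᵐ x ∂cauchyMeasure γ, cayley γ (S x) = powBlaschke K a b (cayley γ x))
    (f g : Lp ℂ 2 (AddCircle.haarAddCircle (T := 2 * π))) :
    Tendsto (fun n ↦
      inner ℂ (koopman (measurePreserving_cayleyAngle hγ) g)
          (koopman (hS.iterate n) (koopman (measurePreserving_cayleyAngle hγ) f)) -
        inner ℂ (koopman (measurePreserving_cayleyAngle hγ) g)
            (indicatorL2 (cauchyMeasure γ) MeasurableSet.univ) *
          inner ℂ (indicatorL2 (cauchyMeasure γ) MeasurableSet.univ)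
            (koopman (measurePreserving_cayleyAngle hγ) f)) atTop (nhds 0) := by
  have hspan : (Submodule.span ℂ (Set.range (fourierLp (T := 2 * π) 2))).topologicalClosure = ⊤ :=
    span_fourierLp_closure_eq_top ENNReal.ofNat_ne_top
  refine tendsto_inner_of_dense_span hspan (koopman (measurePreserving_cayleyAngle hγ))
    (fun n ↦ koopman (hS.iterate n)) (indicatorL2 (cauchyMeasure γ) MeasurableSet.univ) ?_ f g
  rintro _ ⟨j, rfl⟩ _ ⟨k, rfl⟩
  rcases eq_or_ne j 0 with rfl | hj
  · have h1 : inner ℂ (indicatorL2 (cauchyMeasure γ) MeasurableSet.univ)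
        (indicatorL2 (cauchyMeasure γ) MeasurableSet.univ) = 1 := by
      rw [← koopman_fourierLp_zero hγ, LinearIsometry.inner_map_map, inner_self_eq_norm_sq_to_K,
        orthonormal_fourier.1 0]
      simp
    refine tendsto_const_nhds.congr fun n ↦ ?_
    rw [koopman_fourierLp_zero hγ, koopman_indicatorL2 (hS.iterate n), h1, mul_one]
    exact (sub_self _).symm
  · have h0 : inner ℂ (indicatorL2 (cauchyMeasure γ) MeasurableSet.univ)
        (koopman (measurePreserving_cayleyAngle hγ) (fourierLp 2 j)) = 0 := by
      rw [← koopman_fourierLp_zero hγ, LinearIsometry.inner_map_map]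
      exact orthonormal_fourier.2 hj.symm
    refine (tendsto_integral_zpow_mul_zpow hK ha hb hγ hS hsemi (-k) hj).congr fun n ↦ ?_
    rw [h0, mul_zero, sub_zero, inner_koopman_fourierLp hγ (hS.iterate n)]

theorem exists_koopman_eq_indicatorL2 {γ : ℝ} (hγ : 0 < γ) [IsFiniteMeasure (cauchyMeasure γ)]
    {s : Set ℝ} (hs : MeasurableSet s) :
    ∃ f, koopman (measurePreserving_cayleyAngle hγ) f = indicatorL2 (cauchyMeasure γ) hs := by
  have hemb := measurableEmbedding_cayleyAngle hγ
  refine ⟨indicatorL2 _ (hemb.measurableSet_image.mpr hs), ?_⟩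
  rw [koopman_indicatorL2]
  simp only [indicatorL2, Set.preimage_image_eq s hemb.injective]

theorem mixing_of_semiconj_powBlaschke {K : ℕ} {a b γ : ℝ} (hK : 2 ≤ K) (ha : |a| < 1)
    (hb : |b| < 1) (hγ : 0 < γ) {S : ℝ → ℝ}
    (hS : MeasurePreserving S (cauchyMeasure γ) (cauchyMeasure γ))
    (hsemi : ∀ᵐ x ∂cauchyMeasure γ, cayley γ (S x) = powBlaschke K a b (cayley γ x))
    {A B : Set ℝ} (hA : MeasurableSet A) (hB : MeasurableSet B) :
    Tendsto (fun n : ℕ ↦ cauchyMeasure γ (S^[n] ⁻¹' A ∩ B)) atTop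
      (nhds (cauchyMeasure γ A * cauchyMeasure γ B)) := by
  have hprob := isProbabilityMeasure_cauchyMeasure hγ
  obtain ⟨f, hf⟩ := exists_koopman_eq_indicatorL2 hγ hA
  obtain ⟨g, hg⟩ := exists_koopman_eq_indicatorL2 hγ hB
  have hmix := tendsto_inner_koopman_iterate hK ha hb hγ hS hsemi f g
  simp only [hf, hg, koopman_indicatorL2, inner_indicatorL2, Set.inter_univ, Set.univ_inter]
    at hmix
  have hmix' : Tendsto (fun n : ℕ ↦ (cauchyMeasure γ).real (S^[n] ⁻¹' A ∩ B)) atTop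
      (nhds ((cauchyMeasure γ).real A * (cauchyMeasure γ).real B)) := by
    refine tendsto_sub_nhds_zero_iff.mp ?_
    have h := (Complex.continuous_re.tendsto 0).comp hmix
    refine h.congr fun n ↦ ?_
    rw [Function.comp_apply, Set.inter_comm B, ← Complex.ofReal_mul, ← Complex.ofReal_sub,
      Complex.ofReal_re, mul_comm]
  rw [← ENNReal.tendsto_toReal_iff (fun n ↦ measure_ne_top _ _)
    (ENNReal.mul_ne_top (measure_ne_top _ _) (measure_ne_top _ _)), ENNReal.toReal_mul]
  exact hmix'

/-- Under Condition A, the SGB map with its invariant Cauchy measure is mixing: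
for all Borel sets `A`, `B`, `μ((S^n)⁻¹ A ∩ B) → μ(A) μ(B)` as `n → ∞`. -/
theorem sgb_mixing (K : ℕ) (hK : 2 ≤ K) (α : ℝ)
    (hA : (Even K ∧ 0 < α ∧ α < 1) ∨ (Odd K ∧ 1 / (K : ℝ) ^ 2 < α ∧ α < 1))
    (γ : ℝ) (hγ : 0 < γ)
    (hinv : Measure.map (SGB K α) (cauchyMeasure γ) = cauchyMeasure γ) :
    ∀ A B : Set ℝ, MeasurableSet A → MeasurableSet B →
      Filter.Tendsto (fun n : ℕ => cauchyMeasure γ (((SGB K α)^[n]) ⁻¹' A ∩ B))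
        Filter.atTop (nhds (cauchyMeasure γ A * cauchyMeasure γ B)) := by
  intro A B hA' hB'
  have hα : 0 < α := by
    rcases hA with ⟨-, h, -⟩ | ⟨-, h, -⟩
    · exact h
    · exact lt_of_le_of_lt (by positivity) h
  have hβ : 0 < α * K := mul_pos hα (by exact_mod_cast (by omega : 0 < K))
  refine mixing_of_semiconj_powBlaschke hK (abs_sub_div_add_lt_one hγ one_pos)
    (abs_sub_div_add_lt_one hγ hβ) hγ ⟨measurable_SGB K α, hinv⟩ ?_ hA' hB'
  filter_upwards [ae_sin_mul_arccot_ne_zero (by omega : K ≠ 0) γ] with x hx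
  exact cayley_SGB hγ hβ hx
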